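/- The ℕ-graded ℂ[ħ]-module 𝒫 = ⊕_{n∈ℕ} ℂ[ħ][λ₁,…,λ_n]^{S_n} (the degree-n part consisting of polynomials in ħ, λ₁,…,λ_n symmetric in λ₁,…,λ_n) equipped with the shuffle product f⋆g = Σ_{τ∈Sh(n,m)} f(λ_{τ(1)},…,λ_{τ(n)})·g(λ_{τ(n+1)},…,λ_{τ(n+m)})·∏_{s=1}^{n}∏_{t=n+1}^{n+m} (λ_{τ(s)} − λ_{τ(t)} + ħ)/(λ_{τ(t)} − λ_{τ(s)}), computed in the fraction field of ℂ[ħ,λ₁,…,λ_{n+m}] and landing in the degree-(n+m) part by pole cancellation, is an associative, unital, ℕ-graded ℂ[ħ]-algebra, with unit the constant polynomial 1 in degree 0. -/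

import Mathlib

open scoped Classical
open MvPolynomial

noncomputable section

/-- An `(n,m)`-shuffle: a permutation of `{1,…,n+m}` strictly increasing on the
first block `{1,…,n}` and on the second block `{n+1,…,n+m}`. -/
def IsShuffle (n m : ℕ) (τ : Equiv.Perm (Fin (n + m))) : Prop :=
  StrictMono (fun i : Fin n => τ (Fin.castAdd m i)) ∧
  StrictMono (fun j : Fin m => τ (Fin.natAdd n j))

/-- The ring `ℂ[ħ, λ₁, …, λ_n]`, with `none` playing the role of the variable `ħ`
and `some i` the role of `λ_i`. -/
abbrev HPoly (n : ℕ) : Type := MvPolynomial (Option (Fin n)) ℂ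

/-- The degree-`n` piece `ℂ[ħ][λ₁,…,λ_n]^{S_n}` of the shuffle algebra: polynomials
symmetric in the variables `λ₁,…,λ_n`. -/
def SymPoly (n : ℕ) : Type :=
  {p : HPoly n // ∀ σ : Equiv.Perm (Fin n), rename (⇑(Equiv.optionCongr σ)) p = p}

/-- The canonical map into the fraction field. -/
def embO (n : ℕ) : HPoly n →+* FractionRing (HPoly n) := algebraMap _ _

/-- The shuffle product of `f` and `g`, computed in the fraction field of
`ℂ[ħ, λ₁, …, λ_{n+m}]`, with kernel `(λ_s − λ_t + ħ)/(λ_t − λ_s)`. -/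
def sl2ShuffleSum (n m : ℕ) (f : HPoly n) (g : HPoly m) : FractionRing (HPoly (n + m)) :=
  ∑ τ ∈ Finset.univ.filter (fun τ : Equiv.Perm (Fin (n + m)) => IsShuffle n m τ),
    embO (n + m) (rename (Option.map fun s => τ (Fin.castAdd m s)) f) *
    embO (n + m) (rename (Option.map fun t => τ (Fin.natAdd n t)) g) *
    ∏ s : Fin n, ∏ t : Fin m,
      embO (n + m)
          (X (some (τ (Fin.castAdd m s))) - X (some (τ (Fin.natAdd n t))) + X none) /
      embO (n + m)
          (X (some (τ (Fin.natAdd n t))) - X (some (τ (Fin.castAdd m s))))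

/-- Evaluation of a polynomial in `ħ, λ₁, …, λ_n` at `ħ = h`, `λ_i = x i`. -/
def evalAt {n : ℕ} {L : Type*} [CommRing L] [Algebra ℂ L] (h : L) (x : Fin n → L) :
    HPoly n →ₐ[ℂ] L :=
  aeval (fun o => o.elim h x)

section evalAt

variable {n m : ℕ} {L : Type*} [CommRing L] [Algebra ℂ L] (h : L)

@[simp]
lemma evalAt_X_none (x : Fin n → L) : evalAt h x (X none) = h := by
  simp [evalAt]

@[simp]
lemma evalAt_X_some (x : Fin n → L) (i : Fin n) : evalAt h x (X (some i)) = x i := by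
  simp [evalAt]

lemma evalAt_rename (x : Fin m → L) (φ : Fin n → Fin m) (p : HPoly n) :
    evalAt h x (rename (Option.map φ) p) = evalAt h (x ∘ φ) p := by
  rw [evalAt, aeval_rename, evalAt]
  congr 2
  funext o
  cases o <;> rfl

lemma evalAt_polynomial (x : Fin n → L) (q : Polynomial ℂ) :
    evalAt h x (Polynomial.aeval (X none) q) = Polynomial.aeval h q := by
  rw [← Polynomial.aeval_algHom_apply, evalAt_X_none]

lemma evalAt_comp_perm (x : Fin n → L) (f : SymPoly n) (σ : Equiv.Perm (Fin n)) :
    evalAt h (x ∘ σ) f.val = evalAt h x f.val := by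
  conv_rhs => rw [← f.property σ]
  exact (evalAt_rename h x σ f.val).symm

end evalAt

/-- The tautological point `(λ₁, …, λ_n)` over the fraction field. -/
def lambdaPoint (n : ℕ) (i : Fin n) : FractionRing (HPoly n) := embO n (X (some i))

lemma embO_injective (n : ℕ) : Function.Injective (embO n) :=
  IsFractionRing.injective (HPoly n) (FractionRing (HPoly n))

lemma lambdaPoint_injective (n : ℕ) : Function.Injective (lambdaPoint n) := fun i j hij => by
  simpa using embO_injective n hij

lemma evalAt_lambdaPoint (n : ℕ) (p : HPoly n) :
    evalAt (embO n (X none)) (lambdaPoint n) p = embO n p := by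
  have : evalAt (embO n (X none)) (lambdaPoint n) =
      IsScalarTower.toAlgHom ℂ (HPoly n) (FractionRing (HPoly n)) := by
    apply MvPolynomial.algHom_ext
    rintro (_ | i)
    · rw [evalAt_X_none]; rfl
    · rw [evalAt_X_some]; rfl
  rw [this]; rfl

lemma eq_of_evalAt_lambdaPoint {n : ℕ} {p q : HPoly n}
    (hpq : evalAt (embO n (X none)) (lambdaPoint n) p =
      evalAt (embO n (X none)) (lambdaPoint n) q) : p = q := by
  rw [evalAt_lambdaPoint, evalAt_lambdaPoint] at hpq
  exact embO_injective n hpq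

/-- The product `∏ (a_s - b_t + h) / (b_t - a_s)` over all pairs `(s, t)`. -/
def shuffleKernel {n m : ℕ} {L : Type*} [Field L] (h : L) (a : Fin n → L) (b : Fin m → L) : L :=
  ∏ s, ∏ t, (a s - b t + h) / (b t - a s)

lemma shuffleKernel_comp_perm {n m : ℕ} {L : Type*} [Field L] (h : L) (a : Fin n → L)
    (b : Fin m → L) (α : Equiv.Perm (Fin n)) (β : Equiv.Perm (Fin m)) :
    shuffleKernel h (a ∘ α) (b ∘ β) = shuffleKernel h a b := by
  unfold shuffleKernel
  rw [← Equiv.prod_comp α (fun s => ∏ t, (a s - b t + h) / (b t - a s))]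
  refine Finset.prod_congr rfl fun s _ => ?_
  exact Equiv.prod_comp β (fun t => (a (α s) - b t + h) / (b t - a (α s)))

lemma shuffleKernel_add_left {n m k : ℕ} {L : Type*} [Field L] (h : L) (a : Fin (n + m) → L)
    (b : Fin k → L) :
    shuffleKernel h a b =
      shuffleKernel h (a ∘ Fin.castAdd m) b * shuffleKernel h (a ∘ Fin.natAdd n) b := by
  simp only [shuffleKernel, Fin.prod_univ_add, Function.comp_apply]

lemma shuffleKernel_add_right {n m k : ℕ} {L : Type*} [Field L] (h : L) (a : Fin n → L)
    (b : Fin (m + k) → L) :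
    shuffleKernel h a b =
      shuffleKernel h a (b ∘ Fin.castAdd k) * shuffleKernel h a (b ∘ Fin.natAdd m) := by
  simp only [shuffleKernel, Fin.prod_univ_add, Finset.prod_mul_distrib, Function.comp_apply]

/-- The summand of the shuffle product of `f` and `g` attached to an ordering `y` of the
variables. -/
def shuffleTerm {n m : ℕ} {L : Type*} [Field L] [Algebra ℂ L] (f : HPoly n) (g : HPoly m)
    (h : L) (y : Fin (n + m) → L) : L :=
  evalAt h (y ∘ Fin.castAdd m) f * evalAt h (y ∘ Fin.natAdd n) g *
    shuffleKernel h (y ∘ Fin.castAdd m) (y ∘ Fin.natAdd n)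

/-- The permutation of `Fin (n + m)` acting by `α` on the first `n` elements and by `β` on the
last `m` elements. -/
def blockPerm {n m : ℕ} (α : Equiv.Perm (Fin n)) (β : Equiv.Perm (Fin m)) :
    Equiv.Perm (Fin (n + m)) :=
  finSumFinEquiv.permCongr (Equiv.sumCongr α β)

@[simp]
lemma blockPerm_castAdd {n m : ℕ} (α : Equiv.Perm (Fin n)) (β : Equiv.Perm (Fin m)) (i : Fin n) :
    blockPerm α β (Fin.castAdd m i) = Fin.castAdd m (α i) := by
  simp [blockPerm, Equiv.permCongr_apply]

@[simp]
lemma blockPerm_natAdd {n m : ℕ} (α : Equiv.Perm (Fin n)) (β : Equiv.Perm (Fin m)) (j : Fin m) :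
    blockPerm α β (Fin.natAdd n j) = Fin.natAdd n (β j) := by
  simp [blockPerm, Equiv.permCongr_apply]

lemma comp_blockPerm_castAdd {n m : ℕ} {L : Type*} (y : Fin (n + m) → L)
    (α : Equiv.Perm (Fin n)) (β : Equiv.Perm (Fin m)) :
    (y ∘ blockPerm α β) ∘ Fin.castAdd m = (y ∘ Fin.castAdd m) ∘ α := by
  funext i; simp

lemma comp_blockPerm_natAdd {n m : ℕ} {L : Type*} (y : Fin (n + m) → L)
    (α : Equiv.Perm (Fin n)) (β : Equiv.Perm (Fin m)) :
    (y ∘ blockPerm α β) ∘ Fin.natAdd n = (y ∘ Fin.natAdd n) ∘ β := by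
  funext i; simp

lemma shuffleTerm_comp_blockPerm {n m : ℕ} {L : Type*} [Field L] [Algebra ℂ L] (f : SymPoly n)
    (g : SymPoly m) (h : L) (y : Fin (n + m) → L) (α : Equiv.Perm (Fin n))
    (β : Equiv.Perm (Fin m)) :
    shuffleTerm f.val g.val h (y ∘ blockPerm α β) = shuffleTerm f.val g.val h y := by
  unfold shuffleTerm
  rw [comp_blockPerm_castAdd, comp_blockPerm_natAdd, evalAt_comp_perm, evalAt_comp_perm,
    shuffleKernel_comp_perm]

lemma exists_perm_strictMono_comp {n : ℕ} {γ : Type*} [LinearOrder γ] {a : Fin n → γ}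
    (ha : Function.Injective a) : ∃ α : Equiv.Perm (Fin n), StrictMono (a ∘ α) :=
  ⟨Tuple.sort a, (Tuple.monotone_sort a).strictMono_of_injective
    (ha.comp (Tuple.sort a).injective)⟩

/-- A sum over all permutations of a function invariant under block permutations reduces to a
sum over shuffles. -/
lemma sum_perm_eq_sum_shuffle {n m : ℕ} {L : Type*} [Field L]
    (F : Equiv.Perm (Fin (n + m)) → L)
    (hF : ∀ σ α β, F (σ * blockPerm α β) = F σ) :
    ∑ σ, F σ = (n.factorial * m.factorial : L) *
      ∑ τ ∈ Finset.univ.filter (fun τ : Equiv.Perm (Fin (n + m)) => IsShuffle n m τ), F τ := by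
  have key : ∑ p ∈ Finset.univ.filter (fun τ => IsShuffle n m τ) ×ˢ
      (Finset.univ : Finset (Equiv.Perm (Fin n) × Equiv.Perm (Fin m))), F p.1 = ∑ σ, F σ := by
    refine Finset.sum_bij (fun p _ => p.1 * blockPerm p.2.1 p.2.2) (by simp) ?_ ?_ ?_
    · rintro ⟨τ, α, β⟩ hτ ⟨τ', α', β'⟩ hτ' heq
      simp only [Finset.mem_product, Finset.mem_filter, Finset.mem_univ, true_and, and_true]
        at hτ hτ' heq
      have hl : ∀ i, τ (Fin.castAdd m (α i)) = τ' (Fin.castAdd m (α' i)) := fun i => by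
        simpa using DFunLike.congr_fun heq (Fin.castAdd m i)
      have hr : ∀ j, τ (Fin.natAdd n (β j)) = τ' (Fin.natAdd n (β' j)) := fun j => by
        simpa using DFunLike.congr_fun heq (Fin.natAdd n j)
      have hl' := (StrictMono.range_inj hτ.1 hτ'.1).1 (by
        rw [← α.surjective.range_comp, ← α'.surjective.range_comp (fun i => τ' (Fin.castAdd m i))]
        exact congrArg Set.range (_root_.funext hl))
      have hr' := (StrictMono.range_inj hτ.2 hτ'.2).1 (by
        rw [← β.surjective.range_comp, ← β'.surjective.range_comp (fun j => τ' (Fin.natAdd n j))]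
        exact congrArg Set.range (_root_.funext hr))
      obtain rfl : τ = τ' := Equiv.ext fun i =>
        Fin.addCases (fun i => congrFun hl' i) (fun j => congrFun hr' j) i
      obtain rfl : α = α' := Equiv.ext fun i => by simpa using hl i
      obtain rfl : β = β' := Equiv.ext fun i => by simpa using hr i
      rfl
    · intro σ _
      obtain ⟨α, hα⟩ := exists_perm_strictMono_comp
        (σ.injective.comp (Fin.castAdd_injective n m))
      obtain ⟨β, hβ⟩ := exists_perm_strictMono_comp
        (σ.injective.comp (Fin.natAdd_injective m n))
      refine ⟨(σ * blockPerm α β, α⁻¹, β⁻¹), ?_, ?_⟩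
      · simp only [Finset.mem_product, Finset.mem_filter, Finset.mem_univ, true_and, and_true]
        exact ⟨fun i j hij => by simpa using hα hij, fun i j hij => by simpa using hβ hij⟩
      · refine Equiv.ext fun i => ?_
        induction i using Fin.addCases <;> simp
    · intro p _
      exact (hF _ _ _).symm
  rw [← key, Finset.sum_product, Finset.mul_sum]
  simp [Fintype.card_perm]

lemma sum_shuffleTerm_lambdaPoint {n m : ℕ} (f : SymPoly n) (g : SymPoly m) :
    ∑ σ : Equiv.Perm (Fin (n + m)),
      shuffleTerm f.val g.val (embO (n + m) (X none)) (lambdaPoint (n + m) ∘ σ) =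
      (n.factorial * m.factorial : FractionRing (HPoly (n + m))) *
        sl2ShuffleSum n m f.val g.val := by
  rw [sum_perm_eq_sum_shuffle]
  · congr 1
    refine Finset.sum_congr rfl fun τ _ => ?_
    rw [← evalAt_lambdaPoint _ (rename _ f.val), ← evalAt_lambdaPoint _ (rename _ g.val),
      evalAt_rename, evalAt_rename]
    simp [shuffleTerm, shuffleKernel, lambdaPoint, Function.comp_def]
  · intro σ α β
    exact shuffleTerm_comp_blockPerm f g _ (lambdaPoint (n + m) ∘ σ) α β

section divisibility

variable {ι R : Type*} [CommRing R]

lemma X_sub_X_dvd_iff [DecidableEq ι] (i j : ι) (p : MvPolynomial ι R) :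
    X j - X i ∣ p ↔ rename (Function.update id j i) p = 0 := by
  constructor
  · rintro ⟨q, rfl⟩
    by_cases hij : i = j <;> simp [hij]
  · intro hp
    have key : (Ideal.Quotient.mkₐ R (Ideal.span {(X j - X i : MvPolynomial ι R)})).comp
        (rename (Function.update id j i)) =
        Ideal.Quotient.mkₐ R (Ideal.span {(X j - X i : MvPolynomial ι R)}) := by
      apply MvPolynomial.algHom_ext
      intro a
      by_cases ha : a = j
      · subst ha
        simp only [AlgHom.comp_apply, rename_X, Function.update_self, Ideal.Quotient.mkₐ_eq_mk]
        rw [eq_comm, Ideal.Quotient.eq]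
        exact Ideal.mem_span_singleton_self _
      · simp [ha]
    have := DFunLike.congr_fun key p
    rw [AlgHom.comp_apply, hp, map_zero, eq_comm, Ideal.Quotient.mkₐ_eq_mk,
      Ideal.Quotient.eq_zero_iff_mem, Ideal.mem_span_singleton] at this
    exact this

lemma prime_X_sub_X [IsDomain R] {i j : ι} (hij : i ≠ j) :
    Prime (X j - X i : MvPolynomial ι R) := by
  classical
  refine ⟨?_, fun hu => ?_, fun p q hpq => ?_⟩
  · rw [sub_ne_zero]
    exact fun h => hij (X_injective h).symm
  · have := (X_sub_X_dvd_iff i j (1 : MvPolynomial ι R)).1 hu.dvd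
    simp at this
  · simp only [X_sub_X_dvd_iff] at hpq ⊢
    simpa using hpq

lemma isRelPrime_X_sub_X [IsDomain R] {i j a b : ι} (hij : i ≠ j) (hab : a ≠ b)
    (h : ¬(a = i ∧ b = j)) (h' : ¬(a = j ∧ b = i)) :
    IsRelPrime (X j - X i : MvPolynomial ι R) (X b - X a) := by
  classical
  rw [(prime_X_sub_X hij).irreducible.isRelPrime_iff_not_dvd, X_sub_X_dvd_iff]
  intro h0
  rw [map_sub, rename_X, rename_X, sub_eq_zero] at h0
  have h1 := X_injective h0
  simp only [Function.update_apply, id] at h1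
  grind

end divisibility

/-- The Vandermonde product `∏_{i < j} (x_j - x_i)`. -/
def vandermondeProd {N : ℕ} {R : Type*} [CommRing R] (x : Fin N → R) : R :=
  ∏ s ∈ Finset.univ.filter (fun s : Fin N × Fin N => s.1 < s.2), (x s.2 - x s.1)

section vandermondeProd

variable {N : ℕ} {R : Type*} [CommRing R]

lemma vandermondeProd_eq_det (x : Fin N → R) :
    vandermondeProd x = (Matrix.vandermonde x).det := by
  rw [Matrix.det_vandermonde, vandermondeProd, Finset.prod_filter, Fintype.prod_prod_type]
  refine Finset.prod_congr rfl fun i _ => ?_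
  rw [← Finset.prod_filter]
  congr 1
  ext j
  simp

lemma vandermondeProd_comp_perm (x : Fin N → R) (σ : Equiv.Perm (Fin N)) :
    vandermondeProd (x ∘ σ) = (Equiv.Perm.sign σ : ℤ) * vandermondeProd x := by
  rw [vandermondeProd_eq_det, vandermondeProd_eq_det, ← Matrix.det_permute]
  rfl

lemma vandermondeProd_ne_zero [IsDomain R] {x : Fin N → R} (hx : Function.Injective x) :
    vandermondeProd x ≠ 0 := by
  rw [vandermondeProd_eq_det]
  exact Matrix.det_vandermonde_ne_zero_iff.2 hx

lemma map_vandermondeProd {S F : Type*} [CommRing S] [FunLike F R S] [RingHomClass F R S]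
    (φ : F) (x : Fin N → R) : φ (vandermondeProd x) = vandermondeProd (φ ∘ x) := by
  simp [vandermondeProd, map_prod]

lemma prod_block_dvd_vandermondeProd {n m : ℕ} (x : Fin (n + m) → R) :
    ∏ s : Fin n, ∏ t : Fin m, (x (Fin.natAdd n t) - x (Fin.castAdd m s)) ∣
      vandermondeProd x := by
  rw [← Fintype.prod_prod_type'
    (f := fun (s : Fin n) (t : Fin m) => x (Fin.natAdd n t) - x (Fin.castAdd m s))]
  have hinj : Function.Injective
      (fun p : Fin n × Fin m => (Fin.castAdd m p.1, Fin.natAdd n p.2)) := by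
    rintro ⟨a, b⟩ ⟨c, d⟩ h
    simpa using h
  rw [← Finset.prod_image (s := Finset.univ)
    (g := fun p : Fin n × Fin m => (Fin.castAdd m p.1, Fin.natAdd n p.2))
    (f := fun s : Fin (n + m) × Fin (n + m) => x s.2 - x s.1) hinj.injOn]
  refine Finset.prod_dvd_prod_of_subset _ _ _ fun s hs => ?_
  obtain ⟨p, -, rfl⟩ := Finset.mem_image.1 hs
  simp only [Finset.mem_filter, Finset.mem_univ, true_and, Fin.lt_def, Fin.val_castAdd,
    Fin.val_natAdd]
  omega

end vandermondeProd

lemma rename_update_eq_zero_of_alternating {N : ℕ} {Q : HPoly N}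
    (hQ : ∀ ρ : Equiv.Perm (Fin N), rename (Option.map ρ) Q = (Equiv.Perm.sign ρ : ℤ) * Q)
    {i j : Fin N} (hij : i ≠ j) : rename (Function.update id (some j) (some i)) Q = 0 := by
  have h := congrArg (rename (Function.update id (some j) (some i))) (hQ (Equiv.swap i j))
  have hcomp : Function.update id (some j) (some i) ∘ Option.map (Equiv.swap i j) =
      Function.update id (some j) (some i) := by
    funext o
    rcases o with _ | a
    · rfl
    · simp only [Function.comp_apply, Option.map_some, Function.update_apply, id,
        Option.some.injEq, Equiv.swap_apply_def]
      grind
  rw [rename_rename, hcomp, Equiv.Perm.sign_swap hij] at h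
  simpa [self_eq_neg] using h

/-- An alternating polynomial is the Vandermonde product times a symmetric polynomial. -/
lemma exists_symPoly_of_alternating {N : ℕ} {Q : HPoly N}
    (hQ : ∀ ρ : Equiv.Perm (Fin N), rename (Option.map ρ) Q = (Equiv.Perm.sign ρ : ℤ) * Q) :
    ∃ q : SymPoly N, Q = vandermondeProd (fun i => X (some i)) * q.val := by
  have hdvd : vandermondeProd (fun i => (X (some i) : HPoly N)) ∣ Q := by
    refine Finset.prod_dvd_of_isRelPrime (fun s hs t ht hst => ?_) fun s hs => ?_
    · simp only [Finset.coe_filter, Finset.mem_univ, true_and, Set.mem_ofPred_eq] at hs ht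
      refine isRelPrime_X_sub_X (by simpa using hs.ne) (by simpa using ht.ne) ?_ ?_
      · rintro ⟨h1, h2⟩
        exact hst (Prod.ext (Option.some.inj h1).symm (Option.some.inj h2).symm)
      · rintro ⟨h1, h2⟩
        rw [Option.some.inj h1, Option.some.inj h2] at ht
        exact lt_asymm hs ht
    · simp only [Finset.mem_filter, Finset.mem_univ, true_and] at hs
      exact (X_sub_X_dvd_iff _ _ _).2 (rename_update_eq_zero_of_alternating hQ hs.ne)
  obtain ⟨q, rfl⟩ := hdvd
  refine ⟨⟨q, fun σ => ?_⟩, rfl⟩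
  have h := hQ σ
  have hX : Function.Injective (fun i => (X (some i) : HPoly N)) :=
    X_injective.comp (Option.some_injective _)
  have hmap : rename (Option.map σ) (vandermondeProd (fun i => (X (some i) : HPoly N))) =
      (Equiv.Perm.sign σ : ℤ) * vandermondeProd (fun i => (X (some i) : HPoly N)) := by
    rw [map_vandermondeProd, ← vandermondeProd_comp_perm]
    congr 1
    funext i
    simp
  rw [map_mul, hmap, mul_assoc] at h
  have hsign : (((Equiv.Perm.sign σ : ℤˣ) : ℤ) : HPoly N) ≠ 0 := by
    rcases Int.units_eq_one_or (Equiv.Perm.sign σ) with h | h <;> simp [h]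
  exact mul_left_cancel₀ (vandermondeProd_ne_zero hX) (mul_left_cancel₀ hsign h)

/-- Pole cancellation: the symmetrised shuffle product is given by a symmetric polynomial. -/
lemma exists_shuffleProduct {n m : ℕ} (f : SymPoly n) (g : SymPoly m) :
    ∃ p : SymPoly (n + m), ∀ (L : Type) [Field L] [Algebra ℂ L] (h : L) (x : Fin (n + m) → L),
      Function.Injective x →
      (n.factorial * m.factorial : L) * evalAt h x p.val =
        ∑ σ : Equiv.Perm (Fin (n + m)), shuffleTerm f.val g.val h (x ∘ σ) := by
  obtain ⟨D, hD⟩ := prod_block_dvd_vandermondeProd (fun i => (X (some i) : HPoly (n + m)))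
  set P : HPoly (n + m) := rename (Option.map (Fin.castAdd m)) f.val *
    rename (Option.map (Fin.natAdd n)) g.val *
    (∏ s : Fin n, ∏ t : Fin m,
      (X (some (Fin.castAdd m s)) - X (some (Fin.natAdd n t)) + X none)) * D with hP
  have hPeval : ∀ (L : Type) [Field L] [Algebra ℂ L] (h : L) (y : Fin (n + m) → L),
      Function.Injective y →
      evalAt h y P = shuffleTerm f.val g.val h y * vandermondeProd y := by
    intro L _ _ h y hy
    have hV : vandermondeProd y =
        (∏ s : Fin n, ∏ t : Fin m, (y (Fin.natAdd n t) - y (Fin.castAdd m s))) *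
          evalAt h y D := by
      have := congrArg (evalAt h y) hD
      rw [map_vandermondeProd, map_mul] at this
      simpa [map_prod, Function.comp_def] using this
    have hne : ∏ s : Fin n, ∏ t : Fin m, (y (Fin.natAdd n t) - y (Fin.castAdd m s)) ≠ 0 :=
      fun h0 => vandermondeProd_ne_zero hy (by rw [hV, h0, zero_mul])
    rw [hV, hP]
    simp only [map_mul, evalAt_rename, shuffleTerm, shuffleKernel, map_prod, map_add, map_sub,
      evalAt_X_none, evalAt_X_some, Finset.prod_div_distrib, Function.comp_apply]
    field_simp
  clear_value P
  obtain ⟨q, hq⟩ := exists_symPoly_of_alternating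
    (Q := ∑ σ : Equiv.Perm (Fin (n + m)),
      ((Equiv.Perm.sign σ : ℤ) : HPoly (n + m)) * rename (Option.map σ) P) (fun ρ => by
    rw [map_sum, Finset.mul_sum, eq_comm, ← Equiv.sum_comp (Equiv.mulLeft ρ)]
    refine Finset.sum_congr rfl fun σ _ => ?_
    rw [map_mul, map_intCast, rename_rename, Option.map_comp_map]
    rcases Int.units_eq_one_or (Equiv.Perm.sign ρ) with h | h <;>
      simp [h, Equiv.Perm.sign_mul])
  have hc : (n.factorial * m.factorial : ℂ) ≠ 0 := by
    exact_mod_cast mul_ne_zero n.factorial_ne_zero m.factorial_ne_zero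
  refine ⟨⟨C (n.factorial * m.factorial : ℂ)⁻¹ * q.val, fun σ => ?_⟩, ?_⟩
  · rw [map_mul, q.property, rename_C]
  · intro L _ _ h x hx
    have hcL : (n.factorial * m.factorial : L) * evalAt h x (C (n.factorial * m.factorial : ℂ)⁻¹) =
        1 := by
      rw [evalAt, aeval_C]
      have := congrArg (algebraMap ℂ L) (mul_inv_cancel₀ hc)
      simpa using this
    have hqx := congrArg (evalAt h x) hq
    rw [map_mul, map_vandermondeProd, map_sum] at hqx
    have hvx : evalAt h x ∘ (fun i => X (some i)) = x := by
      funext i; simp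
    rw [map_mul, ← mul_assoc, hcL, one_mul]
    apply mul_left_cancel₀ (vandermondeProd_ne_zero hx)
    rw [hvx] at hqx
    rw [← hqx, Finset.mul_sum]
    refine Finset.sum_congr rfl fun σ _ => ?_
    rw [map_mul, evalAt_rename, hPeval L h _ (hx.comp σ.injective), vandermondeProd_comp_perm,
      map_intCast]
    rcases Int.units_eq_one_or (Equiv.Perm.sign σ) with h | h <;> simp [h, mul_comm]

lemma factorial_mul_factorial_ne_zero (n m : ℕ) (L : Type*) [Field L] [Algebra ℂ L] :
    (n.factorial * m.factorial : L) ≠ 0 := by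
  have := charZero_of_injective_algebraMap (algebraMap ℂ L).injective
  exact_mod_cast mul_ne_zero n.factorial_ne_zero m.factorial_ne_zero

/-- The shuffle product on symmetric polynomials. -/
def shuffleMul (n m : ℕ) (f : SymPoly n) (g : SymPoly m) : SymPoly (n + m) :=
  (exists_shuffleProduct f g).choose

section shuffleMul

variable {n m k : ℕ} {L : Type} [Field L] [Algebra ℂ L] (h : L)

lemma evalAt_shuffleMul (f : SymPoly n) (g : SymPoly m) {x : Fin (n + m) → L}
    (hx : Function.Injective x) :
    (n.factorial * m.factorial : L) * evalAt h x (shuffleMul n m f g).val =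
      ∑ σ : Equiv.Perm (Fin (n + m)), shuffleTerm f.val g.val h (x ∘ σ) :=
  (exists_shuffleProduct f g).choose_spec L h x hx

lemma shuffleMul_eq_of_evalAt (f : SymPoly n) (g : SymPoly m) (p : HPoly (n + m))
    (hp : ∑ σ : Equiv.Perm (Fin (n + m)),
        shuffleTerm f.val g.val (embO (n + m) (X none)) (lambdaPoint (n + m) ∘ σ) =
      (n.factorial * m.factorial : FractionRing (HPoly (n + m))) *
        evalAt (embO (n + m) (X none)) (lambdaPoint (n + m)) p) :
    (shuffleMul n m f g).val = p := by
  apply eq_of_evalAt_lambdaPoint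
  apply mul_left_cancel₀ (factorial_mul_factorial_ne_zero n m _)
  rw [evalAt_shuffleMul _ f g (lambdaPoint_injective _), hp]

lemma embO_shuffleMul (f : SymPoly n) (g : SymPoly m) :
    embO (n + m) (shuffleMul n m f g).val = sl2ShuffleSum n m f.val g.val := by
  apply mul_left_cancel₀ (factorial_mul_factorial_ne_zero n m _)
  rw [← sum_shuffleTerm_lambdaPoint, ← evalAt_shuffleMul _ f g (lambdaPoint_injective _),
    evalAt_lambdaPoint]

/-- The summand of a triple shuffle product attached to blocks `a`, `b`, `c` of variables. -/
def shuffleTerm₃ (f : HPoly n) (g : HPoly m) (e : HPoly k) (a : Fin n → L) (b : Fin m → L)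
    (c : Fin k → L) : L :=
  evalAt h a f * evalAt h b g * evalAt h c e *
    (shuffleKernel h a b * shuffleKernel h a c * shuffleKernel h b c)

lemma evalAt_shuffleMul_left (f : SymPoly n) (g : SymPoly m) (e : SymPoly k)
    {x : Fin (n + m + k) → L} (hx : Function.Injective x) :
    (n.factorial * m.factorial * k.factorial : L) *
        evalAt h x (shuffleMul (n + m) k (shuffleMul n m f g) e).val =
      ∑ σ : Equiv.Perm (Fin (n + m + k)),
        shuffleTerm₃ h f.val g.val e.val ((x ∘ σ) ∘ Fin.castAdd k ∘ Fin.castAdd m)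
          ((x ∘ σ) ∘ Fin.castAdd k ∘ Fin.natAdd n) ((x ∘ σ) ∘ Fin.natAdd (n + m)) := by
  set G : (Fin (n + m + k) → L) → L := fun y =>
    shuffleTerm₃ h f.val g.val e.val (y ∘ Fin.castAdd k ∘ Fin.castAdd m)
      (y ∘ Fin.castAdd k ∘ Fin.natAdd n) (y ∘ Fin.natAdd (n + m)) with hG
  have hterm : ∀ y : Fin (n + m + k) → L, Function.Injective y →
      (n.factorial * m.factorial : L) * shuffleTerm (shuffleMul n m f g).val e.val h y =
        ∑ ρ : Equiv.Perm (Fin (n + m)), G (y ∘ blockPerm ρ 1) := by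
    intro y hy
    rw [shuffleTerm, ← mul_assoc, ← mul_assoc,
      evalAt_shuffleMul h f g (hy.comp (Fin.castAdd_injective _ _)), mul_assoc, Finset.sum_mul]
    refine Finset.sum_congr rfl fun ρ _ => ?_
    have h1 := comp_blockPerm_castAdd y ρ (1 : Equiv.Perm (Fin k))
    have h2 := comp_blockPerm_natAdd y ρ (1 : Equiv.Perm (Fin k))
    simp only [hG, ← Function.comp_assoc] at h1 h2 ⊢
    rw [h1, h2, ← shuffleKernel_comp_perm h _ _ ρ 1, shuffleKernel_add_left]
    simp only [shuffleTerm, shuffleTerm₃, Equiv.Perm.coe_one, Function.comp_id]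
    ring
  apply mul_left_cancel₀ (factorial_mul_factorial_ne_zero (n + m) 0 L)
  have hx' := evalAt_shuffleMul h (shuffleMul n m f g) e hx
  calc _ = (n.factorial * m.factorial : L) * (((n + m).factorial * k.factorial : L) *
        evalAt h x (shuffleMul (n + m) k (shuffleMul n m f g) e).val) := by
        simp only [Nat.factorial_zero, Nat.cast_one]; ring
    _ = ∑ ρ : Equiv.Perm (Fin (n + m)), ∑ σ : Equiv.Perm (Fin (n + m + k)),
        G (x ∘ (σ * blockPerm ρ 1 : Equiv.Perm _)) := by
        rw [hx', Finset.mul_sum, Finset.sum_comm]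
        exact Finset.sum_congr rfl fun σ _ => hterm _ (hx.comp σ.injective)
    _ = ∑ ρ : Equiv.Perm (Fin (n + m)), ∑ σ : Equiv.Perm (Fin (n + m + k)), G (x ∘ σ) :=
        Finset.sum_congr rfl fun ρ _ =>
          Equiv.sum_comp (Equiv.mulRight (blockPerm ρ 1)) fun σ => G (x ∘ ⇑σ)
    _ = _ := by simp [Fintype.card_perm, hG]

lemma evalAt_shuffleMul_right (f : SymPoly n) (g : SymPoly m) (e : SymPoly k)
    {x : Fin (n + (m + k)) → L} (hx : Function.Injective x) :
    (n.factorial * m.factorial * k.factorial : L) *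
        evalAt h x (shuffleMul n (m + k) f (shuffleMul m k g e)).val =
      ∑ σ : Equiv.Perm (Fin (n + (m + k))),
        shuffleTerm₃ h f.val g.val e.val ((x ∘ σ) ∘ Fin.castAdd (m + k))
          ((x ∘ σ) ∘ Fin.natAdd n ∘ Fin.castAdd k) ((x ∘ σ) ∘ Fin.natAdd n ∘ Fin.natAdd m) := by
  set G : (Fin (n + (m + k)) → L) → L := fun y =>
    shuffleTerm₃ h f.val g.val e.val (y ∘ Fin.castAdd (m + k))
      (y ∘ Fin.natAdd n ∘ Fin.castAdd k) (y ∘ Fin.natAdd n ∘ Fin.natAdd m) with hG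
  have hterm : ∀ y : Fin (n + (m + k)) → L, Function.Injective y →
      (m.factorial * k.factorial : L) * shuffleTerm f.val (shuffleMul m k g e).val h y =
        ∑ ρ : Equiv.Perm (Fin (m + k)), G (y ∘ blockPerm 1 ρ) := by
    intro y hy
    rw [shuffleTerm, mul_right_comm _ _ (shuffleKernel _ _ _), mul_left_comm,
      evalAt_shuffleMul h g e (hy.comp (Fin.natAdd_injective _ _)), Finset.mul_sum]
    refine Finset.sum_congr rfl fun ρ _ => ?_
    have h1 := comp_blockPerm_castAdd y (1 : Equiv.Perm (Fin n)) ρ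
    have h2 := comp_blockPerm_natAdd y (1 : Equiv.Perm (Fin n)) ρ
    simp only [hG, ← Function.comp_assoc] at h1 h2 ⊢
    rw [h1, h2, ← shuffleKernel_comp_perm h _ _ 1 ρ, shuffleKernel_add_right]
    simp only [shuffleTerm, shuffleTerm₃, Equiv.Perm.coe_one, Function.comp_id]
    ring
  apply mul_left_cancel₀ (factorial_mul_factorial_ne_zero (m + k) 0 L)
  have hx' := evalAt_shuffleMul h f (shuffleMul m k g e) hx
  calc _ = (m.factorial * k.factorial : L) * ((n.factorial * (m + k).factorial : L) *
        evalAt h x (shuffleMul n (m + k) f (shuffleMul m k g e)).val) := by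
        simp only [Nat.factorial_zero, Nat.cast_one]; ring
    _ = ∑ ρ : Equiv.Perm (Fin (m + k)), ∑ σ : Equiv.Perm (Fin (n + (m + k))),
        G (x ∘ (σ * blockPerm 1 ρ : Equiv.Perm _)) := by
        rw [hx', Finset.mul_sum, Finset.sum_comm]
        exact Finset.sum_congr rfl fun σ _ => hterm _ (hx.comp σ.injective)
    _ = ∑ ρ : Equiv.Perm (Fin (m + k)), ∑ σ : Equiv.Perm (Fin (n + (m + k))), G (x ∘ σ) :=
        Finset.sum_congr rfl fun ρ _ =>
          Equiv.sum_comp (Equiv.mulRight (blockPerm 1 ρ)) fun σ => G (x ∘ ⇑σ)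
    _ = _ := by simp [Fintype.card_perm, hG]

lemma shuffleMul_assoc (f : SymPoly n) (g : SymPoly m) (e : SymPoly k) :
    (shuffleMul (n + m) k (shuffleMul n m f g) e).val =
      rename (Option.map (Fin.cast (Nat.add_assoc n m k).symm))
        (shuffleMul n (m + k) f (shuffleMul m k g e)).val := by
  apply eq_of_evalAt_lambdaPoint
  have hx := lambdaPoint_injective (n + m + k)
  have hne := mul_ne_zero
    (factorial_mul_factorial_ne_zero n m (FractionRing (HPoly (n + m + k))))
    (left_ne_zero_of_mul
      (factorial_mul_factorial_ne_zero k 0 (FractionRing (HPoly (n + m + k)))))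
  apply mul_left_cancel₀ hne
  rw [evalAt_rename, evalAt_shuffleMul_left _ f g e hx,
    evalAt_shuffleMul_right _ f g e (hx.comp (Fin.cast_injective _)),
    ← Equiv.sum_comp (finCongr (Nat.add_assoc n m k).symm).permCongr]
  refine Finset.sum_congr rfl fun σ _ => ?_
  congr 1
  funext i
  simp only [Function.comp_apply, Equiv.permCongr_apply, finCongr_apply, finCongr_symm]
  congr 3
  ext
  simp [Nat.add_assoc]

end shuffleMul

lemma shuffleMul_unit_left (n : ℕ) (u : SymPoly 0) (hu : u.val = 1) (f : SymPoly n) :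
    (shuffleMul 0 n u f).val = rename (Option.map (Fin.cast (Nat.zero_add n).symm)) f.val := by
  apply shuffleMul_eq_of_evalAt
  rw [evalAt_rename]
  have hsum : ∀ σ : Equiv.Perm (Fin (0 + n)),
      shuffleTerm u.val f.val (embO (0 + n) (X none)) (lambdaPoint (0 + n) ∘ σ) =
      evalAt (embO (0 + n) (X none))
        (lambdaPoint (0 + n) ∘ Fin.cast (Nat.zero_add n).symm) f.val := by
    intro σ
    rw [← evalAt_comp_perm _ (lambdaPoint (0 + n) ∘ Fin.cast (Nat.zero_add n).symm) f
      ((finCongr (Nat.zero_add n)).permCongr σ)]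
    have harg : (lambdaPoint (0 + n) ∘ σ) ∘ Fin.natAdd 0 =
        (lambdaPoint (0 + n) ∘ Fin.cast (Nat.zero_add n).symm) ∘
          (finCongr (Nat.zero_add n)).permCongr σ := by
      funext i
      simp only [Function.comp_apply, Equiv.permCongr_apply, finCongr_apply, finCongr_symm]
      congr 2
      ext; simp
    rw [shuffleTerm, harg]
    simp [shuffleKernel, hu]
  simp [hsum, Fintype.card_perm]

lemma shuffleMul_unit_right (n : ℕ) (u : SymPoly 0) (hu : u.val = 1) (f : SymPoly n) :
    (shuffleMul n 0 f u).val = f.val := by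
  apply shuffleMul_eq_of_evalAt
  have hsum : ∀ σ : Equiv.Perm (Fin (n + 0)),
      shuffleTerm f.val u.val (embO (n + 0) (X none)) (lambdaPoint (n + 0) ∘ σ) =
      evalAt (embO (n + 0) (X none)) (lambdaPoint (n + 0)) f.val := by
    intro σ
    rw [← evalAt_comp_perm _ (lambdaPoint (n + 0)) f σ]
    simp [shuffleTerm, shuffleKernel, hu, Function.comp_def]
  rw [Finset.sum_congr rfl fun σ _ => hsum σ]
  simp [Fintype.card_perm]

/-- The graded module `𝒫 = ⊕ₙ ℂ[ħ][λ₁,…,λ_n]^{Sₙ}` equipped with the shuffle product is an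
associative, unital, ℕ-graded `ℂ[ħ]`-algebra: there is a multiplication
`SymPoly n → SymPoly m → SymPoly (n+m)` which is computed by the shuffle formula in the
fraction field (pole cancellation), is `ℂ[ħ]`-bilinear, associative, and has the constant
polynomial `1` in degree `0` as unit. -/
theorem sl2_shuffle_algebra :
    ∃ mul : ∀ n m : ℕ, SymPoly n → SymPoly m → SymPoly (n + m),
      -- the product is computed by the shuffle formula in the fraction field
      (∀ (n m : ℕ) (f : SymPoly n) (g : SymPoly m),
        embO (n + m) (mul n m f g).val = sl2ShuffleSum n m f.val g.val) ∧
      -- additivity in the left argument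
      (∀ (n m : ℕ) (f f' fs : SymPoly n) (g : SymPoly m), fs.val = f.val + f'.val →
        (mul n m fs g).val = (mul n m f g).val + (mul n m f' g).val) ∧
      -- additivity in the right argument
      (∀ (n m : ℕ) (f : SymPoly n) (g g' gs : SymPoly m), gs.val = g.val + g'.val →
        (mul n m f gs).val = (mul n m f g).val + (mul n m f g').val) ∧
      -- ℂ[ħ]-linearity in the left argument
      (∀ (n m : ℕ) (q : Polynomial ℂ) (f fq : SymPoly n) (g : SymPoly m),
        fq.val = Polynomial.aeval (X (none : Option (Fin n))) q * f.val →
        (mul n m fq g).val =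
          Polynomial.aeval (X (none : Option (Fin (n + m)))) q * (mul n m f g).val) ∧
      -- ℂ[ħ]-linearity in the right argument
      (∀ (n m : ℕ) (q : Polynomial ℂ) (f : SymPoly n) (g gq : SymPoly m),
        gq.val = Polynomial.aeval (X (none : Option (Fin m))) q * g.val →
        (mul n m f gq).val =
          Polynomial.aeval (X (none : Option (Fin (n + m)))) q * (mul n m f g).val) ∧
      -- associativity
      (∀ (n m k : ℕ) (f : SymPoly n) (g : SymPoly m) (h : SymPoly k),
        (mul (n + m) k (mul n m f g) h).val =
          rename (Option.map (Fin.cast (Nat.add_assoc n m k).symm))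
            (mul n (m + k) f (mul m k g h)).val) ∧
      -- the unit: the constant polynomial 1 in degree 0
      (∃ one : SymPoly 0, one.val = 1 ∧
        ∀ (n : ℕ) (f : SymPoly n),
          (mul 0 n one f).val =
            rename (Option.map (Fin.cast (Nat.zero_add n).symm)) f.val ∧
          (mul n 0 f one).val = f.val) := by
  have hx := fun N => lambdaPoint_injective N
  refine ⟨shuffleMul, fun n m f g => embO_shuffleMul f g, ?_, ?_, ?_, ?_,
    fun n m k f g e => shuffleMul_assoc f g e, ?_⟩
  · intro n m f f' fs g hfs
    apply shuffleMul_eq_of_evalAt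
    rw [map_add, mul_add, evalAt_shuffleMul _ f g (hx _), evalAt_shuffleMul _ f' g (hx _),
      ← Finset.sum_add_distrib]
    refine Finset.sum_congr rfl fun σ _ => ?_
    simp only [shuffleTerm, hfs, map_add]
    ring
  · intro n m f g g' gs hgs
    apply shuffleMul_eq_of_evalAt
    rw [map_add, mul_add, evalAt_shuffleMul _ f g (hx _), evalAt_shuffleMul _ f g' (hx _),
      ← Finset.sum_add_distrib]
    refine Finset.sum_congr rfl fun σ _ => ?_
    simp only [shuffleTerm, hgs, map_add]
    ring
  · intro n m q f fq g hfq
    apply shuffleMul_eq_of_evalAt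
    rw [map_mul, mul_left_comm, evalAt_shuffleMul _ f g (hx _), Finset.mul_sum]
    refine Finset.sum_congr rfl fun σ _ => ?_
    simp only [shuffleTerm, hfq, map_mul, evalAt_polynomial]
    ring
  · intro n m q f g gq hgq
    apply shuffleMul_eq_of_evalAt
    rw [map_mul, mul_left_comm, evalAt_shuffleMul _ f g (hx _), Finset.mul_sum]
    refine Finset.sum_congr rfl fun σ _ => ?_
    simp only [shuffleTerm, hgq, map_mul, evalAt_polynomial]
    ring
  · exact ⟨⟨1, fun σ => map_one _⟩, rfl, fun n f =>
      ⟨shuffleMul_unit_left n _ rfl f, shuffleMul_unit_right n _ rfl f⟩⟩
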